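/- Suppose 0 < ε < 10^{-5}, t is an odd integer with t ≥ 3, and n is a positive integer with n ≥ tε^{-2}. Suppose V_0, …, V_{t−1} are disjoint vertex sets in a graph, indexed by the elements of Z/tZ, such that for each i ∈ Z/tZ: |V_i| ≥ n, the pair (V_i, V_{i+1}) is ε-regular, and d(V_i, V_{i+1}) ≥ d for some d ≥ 10ε^{1/2}. Then for any odd positive integer p with 2t + 6 ≤ p ≤ t(1 − 5√ε)n, the number of cycles of length p in the graph is at least (ε²/4) · n⁴ · (d − 10√ε)^{p−2} · (1 − 3√ε)^{2p} · ∏_{i=1}^{p−4} (n − ⌊i/t⌋). -/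

import Mathlib

open Finset
open scoped Classical

noncomputable section

/-- Number of ordered pairs `(x, y) ∈ X × Y` that are adjacent in `G`. -/
def interPairs {V : Type*} (G : SimpleGraph V) (X Y : Finset V) : ℕ :=
  ((X ×ˢ Y).filter fun p => G.Adj p.1 p.2).card

/-- The edge density `d(X, Y) = e(X, Y) / (|X| |Y|)` between disjoint sets `X` and `Y`. -/
def dens {V : Type*} (G : SimpleGraph V) (X Y : Finset V) : ℝ :=
  (interPairs G X Y : ℝ) / ((X.card : ℝ) * (Y.card : ℝ))

/-- `(X, Y)` is an `ε`-regular pair. -/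
def IsRegularPair {V : Type*} (G : SimpleGraph V) (ε : ℝ) (X Y : Finset V) : Prop :=
  ∀ U ⊆ X, ∀ W ⊆ Y, ε * X.card ≤ (U.card : ℝ) → ε * Y.card ≤ (W.card : ℝ) →
    |dens G U W - dens G X Y| ≤ ε

/-- The number of cycles with `p` vertices in `G`, counted as subgraphs. -/
def cycleCount {V : Type*} (G : SimpleGraph V) (p : ℕ) : ℕ :=
  Nat.card {f : ZMod p → V // Function.Injective f ∧ ∀ i, G.Adj (f i) (f (i + 1))} / (2 * p)

lemma interPairs_eq_sum {V : Type*} (G : SimpleGraph V) (X Y : Finset V) :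
    interPairs G X Y = ∑ x ∈ X, #{y ∈ Y | G.Adj x y} := by
  simp only [interPairs, card_filter, sum_product]

lemma interPairs_comm {V : Type*} (G : SimpleGraph V) (X Y : Finset V) :
    interPairs G X Y = interPairs G Y X := by
  simp only [interPairs, card_filter, sum_product]
  rw [sum_comm]
  simp only [G.adj_comm]

lemma dens_comm {V : Type*} (G : SimpleGraph V) (X Y : Finset V) :
    dens G X Y = dens G Y X := by
  rw [_root_.dens, _root_.dens, interPairs_comm, mul_comm]

lemma dens_le_one {V : Type*} (G : SimpleGraph V) (X Y : Finset V) : dens G X Y ≤ 1 := by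
  refine div_le_one_of_le₀ ?_ (by positivity)
  have h : interPairs G X Y ≤ #X * #Y := by
    rw [← card_product]
    exact card_filter_le _ _
  exact_mod_cast h

lemma IsRegularPair.symm {V : Type*} {G : SimpleGraph V} {ε : ℝ} {X Y : Finset V}
    (h : IsRegularPair G ε X Y) : IsRegularPair G ε Y X := by
  intro U hU W hW hU' hW'
  rw [dens_comm G U, dens_comm G Y]
  exact h W hW U hU hW' hU'

/-- All but an `ε`-fraction of the vertices of `X` have relative degree at least `d - ε` into any
given subset of `Y` that contains at least an `ε`-fraction of `Y`. -/
def HasTypicalDegrees {V : Type*} (G : SimpleGraph V) (ε d : ℝ) (X Y : Finset V) : Prop :=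
  ∀ W ⊆ Y, ε * #Y ≤ #W →
    (#{x ∈ X | (#{y ∈ W | G.Adj x y} : ℝ) < (d - ε) * #W} : ℝ) ≤ ε * #X

lemma IsRegularPair.hasTypicalDegrees {V : Type*} {G : SimpleGraph V} {ε d : ℝ}
    {X Y : Finset V} (hε : 0 < ε) (h : IsRegularPair G ε X Y) (hd : d ≤ dens G X Y) :
    HasTypicalDegrees G ε d X Y := by
  intro W hW hWc
  by_contra! hlt
  set U := {x ∈ X | (#{y ∈ W | G.Adj x y} : ℝ) < (d - ε) * #W} with hU
  have hUne : U.Nonempty := by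
    rw [← card_pos]
    have : (0 : ℝ) < #U := lt_of_le_of_lt (by positivity) hlt
    exact_mod_cast this
  have hWne : W.Nonempty := by
    obtain ⟨x, hx⟩ := hUne
    rw [nonempty_iff_ne_empty]
    rintro rfl
    simp [hU] at hx
  have hUpos : (0 : ℝ) < #U := by exact_mod_cast hUne.card_pos
  have hWpos : (0 : ℝ) < #W := by exact_mod_cast hWne.card_pos
  have hreg := (abs_le.1 (h U (filter_subset _ _) W hW hlt.le hWc)).1
  have hsum : (interPairs G U W : ℝ) < (d - ε) * (#U * #W) := by
    rw [interPairs_eq_sum]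
    push_cast
    calc (∑ x ∈ U, (#{y ∈ W | G.Adj x y} : ℝ)) < ∑ _x ∈ U, (d - ε) * #W :=
          sum_lt_sum_of_nonempty hUne fun x hx => (mem_filter.1 hx).2
      _ = (d - ε) * (#U * #W) := by rw [sum_const, nsmul_eq_mul]; ring
  have hlt' : dens G U W < d - ε := by
    rw [_root_.dens, div_lt_iff₀ (by positivity)]
    exact hsum
  linarith

/-- If a sequence satisfying `P j` can always be continued in at least `c j` ways, then there are
at least `∏ c j` continuations. -/
lemma exists_finset_prod_le_card {V : Type*} (P : ℕ → (ℕ → V) → Prop) (c : ℕ → ℝ) (z : ℕ → V)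
    (m : ℕ) (hc : ∀ j < m, 0 ≤ c j) (h0 : P 0 z)
    (hstep : ∀ j < m, ∀ f, P j f →
      ∃ E : Finset V, c j ≤ #E ∧ ∀ x ∈ E, P (j + 1) (Function.update f j x)) :
    ∃ S : Finset (ℕ → V), (∀ f ∈ S, P m f ∧ ∀ k, m ≤ k → f k = z k) ∧
      ∏ j ∈ range m, c j ≤ #S := by
  induction m with
  | zero => exact ⟨{z}, by simpa using h0, by simp⟩
  | succ m ih =>
    obtain ⟨S, hS, hcard⟩ := ih (fun j hj => hc j (by omega)) fun j hj => hstep j (by omega)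
    have hE : ∀ f : ℕ → V, ∃ E : Finset V, f ∈ S →
        c m ≤ #E ∧ ∀ x ∈ E, P (m + 1) (Function.update f m x) := by
      intro f
      by_cases hf : f ∈ S
      · obtain ⟨E, hE⟩ := hstep m (by omega) f (hS f hf).1
        exact ⟨E, fun _ => hE⟩
      · exact ⟨∅, fun h => absurd h hf⟩
    choose E hE using hE
    refine ⟨S.biUnion fun f => (E f).image (Function.update f m), ?_, ?_⟩
    · intro g hg
      obtain ⟨f, hf, hg⟩ := mem_biUnion.1 hg
      obtain ⟨x, hx, rfl⟩ := mem_image.1 hg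
      refine ⟨(hE f hf).2 x hx, fun k hk => ?_⟩
      rw [Function.update_of_ne (by omega)]
      exact (hS f hf).2 k (by omega)
    · rw [card_biUnion, prod_range_succ, Nat.cast_sum]
      · calc (∏ j ∈ range m, c j) * c m ≤ #S * c m :=
              mul_le_mul_of_nonneg_right hcard (hc m (by omega))
          _ = ∑ _f ∈ S, c m := by rw [sum_const, nsmul_eq_mul]
          _ ≤ _ := by
            refine sum_le_sum fun f hf => ?_
            rw [card_image_of_injective _ (Function.update_injective f m)]
            exact (hE f hf).1
      · intro f hf g hg hfg
        rw [Function.onFun, disjoint_left]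
        intro h hfh hgh
        obtain ⟨x, -, rfl⟩ := mem_image.1 hfh
        obtain ⟨y, -, hy⟩ := mem_image.1 hgh
        refine hfg (funext fun k => ?_)
        by_cases hk : k = m
        · rw [hk, (hS f hf).2 m le_rfl, (hS g hg).2 m le_rfl]
        · have := congrFun hy k
          rw [Function.update_of_ne hk, Function.update_of_ne hk] at this
          exact this.symm

/-- The vertices that may be chosen at position `k + 1` of a path with vertices
`f 0, …, f k`, where the set `R` is reserved for the last position `m`. -/
def candidates {V : Type*} (A : ℕ → Finset V) (R : Finset V) (m k : ℕ) (f : ℕ → V) : Finset V :=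
  if k + 1 = m then R else (A (k + 1) \ R) \ (range k).image f

lemma candidates_congr {V : Type*} {A : ℕ → Finset V} {R : Finset V} {m k : ℕ} {f g : ℕ → V}
    (h : ∀ i < k, f i = g i) : candidates A R m k f = candidates A R m k g := by
  have : (range k).image f = (range k).image g :=
    image_congr fun i hi => h i (by simpa using hi)
  rw [candidates, candidates, this]

/-- `f 0, …, f k` is a path with `f i ∈ A i` that can be extended in many ways, and which avoids
the set `R (f 0)` of neighbours of `f 0` until position `m`. -/
structure IsExtendablePath {V : Type*} (G : SimpleGraph V) (ε d : ℝ) (A : ℕ → Finset V)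
    (R : V → Finset V) (m k : ℕ) (f : ℕ → V) : Prop where
  mem : ∀ i ≤ k, f i ∈ A i
  inj : ∀ i j, i < j → j ≤ k → f i ≠ f j
  adj : ∀ i < k, G.Adj (f i) (f (i + 1))
  notMem : ∀ i ≤ k, i < m → f i ∉ R (f 0)
  large : ε * #(A m) ≤ #(R (f 0))
  last : k = m → f m ∈ R (f 0)
  degree : k < m → (d - ε) * #(candidates A (R (f 0)) m k f) ≤
    #{y ∈ candidates A (R (f 0)) m k f | G.Adj (f k) y}

lemma IsExtendablePath.update {V : Type*} {G : SimpleGraph V} {ε d : ℝ} {A : ℕ → Finset V}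
    {R : V → Finset V} {m k : ℕ} {f : ℕ → V} (hf : IsExtendablePath G ε d A R m k f)
    (hkm : k < m) (hR : ∀ v, R v ⊆ A m) {x : V}
    (hx : x ∈ candidates A (R (f 0)) m k f) (hadj : G.Adj (f k) x)
    (hdeg : k + 1 < m → (d - ε) * #(candidates A (R (f 0)) m (k + 1) f) ≤
      #{y ∈ candidates A (R (f 0)) m (k + 1) f | G.Adj x y}) :
    IsExtendablePath G ε d A R m (k + 1) (Function.update f (k + 1) x) := by
  have hlt : ∀ i ≤ k, Function.update f (k + 1) x i = f i := fun i hi =>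
    Function.update_of_ne (by omega) _ _
  have hself : Function.update f (k + 1) x (k + 1) = x := Function.update_self _ _ _
  have h0 := hlt 0 (by omega)
  have hxA : x ∈ A (k + 1) := by
    rw [candidates] at hx
    split_ifs at hx with h
    · exact h ▸ hR _ hx
    · exact (mem_sdiff.1 (mem_sdiff.1 hx).1).1
  have hnew : ∀ i ≤ k, f i ≠ x := by
    intro i hi hix
    rcases hi.lt_or_eq with hi' | rfl
    · rw [candidates] at hx
      split_ifs at hx with h
      · exact hf.notMem i hi (by omega) (hix ▸ hx)
      · exact (mem_sdiff.1 hx).2 (mem_image.2 ⟨i, mem_range.2 hi', hix⟩)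
    · exact hadj.ne hix
  constructor
  · intro i hi
    rcases Nat.le_succ_iff.1 hi with hi | rfl
    · rw [hlt i hi]; exact hf.mem i hi
    · rwa [hself]
  · intro i j hij hj
    rw [hlt i (by omega)]
    rcases Nat.le_succ_iff.1 hj with hj | rfl
    · rw [hlt j hj]; exact hf.inj i j hij hj
    · rw [hself]; exact hnew i (by omega)
  · intro i hi
    rw [hlt i (by omega)]
    rcases Nat.lt_succ_iff_lt_or_eq.1 hi with hi | rfl
    · rw [hlt (i + 1) (by omega)]; exact hf.adj i hi
    · rwa [hself]
  · intro i hi him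
    rw [h0]
    rcases Nat.le_succ_iff.1 hi with hi | rfl
    · rw [hlt i hi]; exact hf.notMem i hi him
    · rw [hself]
      rw [candidates, if_neg (by omega)] at hx
      exact (mem_sdiff.1 (mem_sdiff.1 hx).1).2
  · rw [h0]; exact hf.large
  · intro h
    rw [h0, ← h, hself]
    rwa [candidates, if_pos h] at hx
  · intro h
    rw [h0, hself, candidates_congr (g := f) fun i hi => hlt i (by omega)]
    exact hdeg h

/-- Lower bound for the number of cycles `f 0, …, f m` with `f j ∈ Vs (w j)`. -/
lemma exists_finset_cycles {V ι : Type*} [DecidableEq ι] (G : SimpleGraph V) {ε d : ℝ} (Vs : ι → Finset V)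
    (hdisj : ∀ i j, i ≠ j → Disjoint (Vs i) (Vs j)) (w : ℕ → ι) {m : ℕ} (hm : 2 ≤ m)
    (hw0 : w m ≠ w 0) (hw1 : w m ≠ w 1)
    (htyp : ∀ j < m, HasTypicalDegrees G ε d (Vs (w j)) (Vs (w (j + 1))))
    (htyp' : HasTypicalDegrees G ε d (Vs (w 0)) (Vs (w m)))
    (hε : 0 < ε) (hε1 : ε ≤ 1) (hd : 2 * ε ≤ d) (hbig : 1 ≤ ε * #(Vs (w m)))
    (hroom : ∀ k, k + 1 < m → ε * #(Vs (w (k + 1))) ≤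
      (1 - 2 * ε) * #(Vs (w (k + 1))) - #{i ∈ range k | w i = w (k + 1)})
    (c : ℕ → ℝ) (hc : ∀ j, 0 ≤ c j) (hc0 : c 0 ≤ (1 - 2 * ε) * #(Vs (w 0)))
    (hck : ∀ k, k + 1 < m → c (k + 1) ≤
      (d - ε) * ((1 - 2 * ε) * #(Vs (w (k + 1))) - #{i ∈ range k | w i = w (k + 1)}) -
        ε * #(Vs (w (k + 1))))
    (hcm : c m ≤ (d - ε) * (ε * #(Vs (w m)))) (z : ℕ → V) :
    ∃ S : Finset (ℕ → V), ∏ j ∈ range (m + 1), c j ≤ #S ∧ ∀ f ∈ S,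
      (∀ i ≤ m, f i ∈ Vs (w i)) ∧ (∀ i j, i < j → j ≤ m → f i ≠ f j) ∧
      (∀ i < m, G.Adj (f i) (f (i + 1))) ∧ G.Adj (f m) (f 0) ∧
      ∀ k, m + 1 ≤ k → f k = z k := by
  have hRex : ∀ v, ∃ R ⊆ {y ∈ Vs (w m) | G.Adj v y}, (#R : ℝ) ≤ 2 * ε * #(Vs (w m)) ∧
      (ε * #(Vs (w m)) ≤ #{y ∈ Vs (w m) | G.Adj v y} → ε * #(Vs (w m)) ≤ #R) := by
    intro v
    by_cases h : ε * #(Vs (w m)) ≤ #{y ∈ Vs (w m) | G.Adj v y}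
    · obtain ⟨R, hR, hRc⟩ := exists_subset_card_eq (Nat.ceil_le.2 h)
      refine ⟨R, hR, ?_, fun _ => ?_⟩
      · rw [hRc]
        have := Nat.ceil_lt_add_one (a := ε * (#(Vs (w m)) : ℝ)) (by linarith)
        linarith
      · rw [hRc]
        exact Nat.le_ceil _
    · exact ⟨∅, empty_subset _, by simp; positivity, fun h' => absurd h' h⟩
  choose R hRsub hRle hRge using hRex
  have hRA : ∀ v, R v ⊆ Vs (w m) := fun v => (hRsub v).trans (filter_subset _ _)
  set A : ℕ → Finset V := fun j => Vs (w j) with hA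
  have hcand : ∀ k f, k + 1 < m → IsExtendablePath G ε d A R m k f ∨ (∀ i < k, f i ∈ A i) →
      (1 - 2 * ε) * #(A (k + 1)) - #{i ∈ range k | w i = w (k + 1)} ≤
        (#(candidates A (R (f 0)) m k f) : ℝ) := by
    intro k f hk hf
    have hmem : ∀ i < k, f i ∈ A i := hf.elim (fun h i hi => h.mem i hi.le) id
    have h1 : (#(R (f 0) ∩ A (k + 1)) : ℝ) ≤ 2 * ε * #(A (k + 1)) := by
      by_cases h : w (k + 1) = w m
      · have := card_le_card (inter_subset_left (s₁ := R (f 0)) (s₂ := A (k + 1)))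
        have h' : (#(R (f 0) ∩ A (k + 1)) : ℝ) ≤ #(R (f 0)) := by exact_mod_cast this
        have h'' := hRle (f 0)
        simp only [hA, h] at h' ⊢
        linarith
      · have : R (f 0) ∩ A (k + 1) = ∅ := by
          rw [← disjoint_iff_inter_eq_empty]
          exact (hdisj _ _ (Ne.symm h)).mono_left (hRA _)
        rw [this]
        simp only [card_empty, Nat.cast_zero]
        positivity
    have h2 : #((range k).image f ∩ A (k + 1)) ≤ #{i ∈ range k | w i = w (k + 1)} := by
      refine (card_le_card (t := ({i ∈ range k | w i = w (k + 1)}).image f) ?_).trans card_image_le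
      intro x hx
      obtain ⟨hx, hxA⟩ := mem_inter.1 hx
      obtain ⟨i, hi, rfl⟩ := mem_image.1 hx
      refine mem_image.2 ⟨i, mem_filter.2 ⟨hi, ?_⟩, rfl⟩
      by_contra h
      exact disjoint_left.1 (hdisj _ _ h) (hmem i (mem_range.1 hi)) hxA
    have h3 : #(A (k + 1)) ≤ #(candidates A (R (f 0)) m k f) + #(R (f 0) ∩ A (k + 1)) +
        #((range k).image f ∩ A (k + 1)) := by
      rw [candidates, if_neg (by omega)]
      refine (card_le_card ?_).trans ((card_union_le _ _).trans
        (Nat.add_le_add_right (card_union_le _ _) _))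
      intro x hx
      simp only [mem_union, mem_sdiff, mem_inter]
      tauto
    have h2' : (#((range k).image f ∩ A (k + 1)) : ℝ) ≤ #{i ∈ range k | w i = w (k + 1)} := by
      exact_mod_cast h2
    have h3' : (#(A (k + 1)) : ℝ) ≤ #(candidates A (R (f 0)) m k f) + #(R (f 0) ∩ A (k + 1)) +
        #((range k).image f ∩ A (k + 1)) := by exact_mod_cast h3
    linarith
  have hcandsub : ∀ k f, candidates A (R (f 0)) m k f ⊆ A (k + 1) := by
    intro k f
    rw [candidates]
    split_ifs with h
    · rw [h]; exact hRA _
    · exact sdiff_subset.trans sdiff_subset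
  let P : ℕ → (ℕ → V) → Prop := fun j f => ∀ k, j = k + 1 → IsExtendablePath G ε d A R m k f
  obtain ⟨S, hS, hcard⟩ := exists_finset_prod_le_card P c z (m + 1) (fun j _ => hc j)
    (by intro k hk; omega) (by
      intro j hj f hf
      rcases Nat.eq_zero_or_pos j with rfl | hjpos
      · have b1 := htyp 0 (by omega) (A 1) subset_rfl (by
          have : (0 : ℝ) ≤ #(A 1) := by positivity
          change ε * #(A 1) ≤ _
          nlinarith)
        have b2 := htyp' (A m) subset_rfl (by
          have : (0 : ℝ) ≤ #(A m) := by positivity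
          change ε * #(A m) ≤ _
          nlinarith)
        set B1 := {x ∈ Vs (w 0) | (#{y ∈ A 1 | G.Adj x y} : ℝ) < (d - ε) * #(A 1)}
        set B2 := {x ∈ Vs (w 0) | (#{y ∈ A m | G.Adj x y} : ℝ) < (d - ε) * #(A m)}
        refine ⟨(A 0 \ B1) \ B2, ?_, ?_⟩
        · have h : #(A 0) ≤ #((A 0 \ B1) \ B2) + #B1 + #B2 := by
            refine (card_le_card ?_).trans ((card_union_le _ _).trans
              (Nat.add_le_add_right (card_union_le _ _) _))
            intro x hx
            simp only [mem_union, mem_sdiff]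
            tauto
          have h' : (#(A 0) : ℝ) ≤ #((A 0 \ B1) \ B2) + #B1 + #B2 := by exact_mod_cast h
          simp only [hA] at h' b1 b2 ⊢
          linarith
        · intro x hx k hk
          obtain rfl : k = 0 := by omega
          obtain ⟨hx, hx2⟩ := mem_sdiff.1 hx
          obtain ⟨hx, hx1⟩ := mem_sdiff.1 hx
          have hx1' : (d - ε) * #(A 1) ≤ #{y ∈ A 1 | G.Adj x y} := by
            by_contra! h
            exact hx1 (mem_filter.2 ⟨hx, h⟩)
          have hx2' : (d - ε) * #(A m) ≤ #{y ∈ A m | G.Adj x y} := by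
            by_contra! h
            exact hx2 (mem_filter.2 ⟨hx, h⟩)
          have hself : Function.update f 0 x 0 = x := Function.update_self _ _ _
          constructor
          · intro i hi
            obtain rfl : i = 0 := by omega
            rwa [hself]
          · intro i j _ _
            omega
          · intro i hi
            omega
          · intro i hi _
            obtain rfl : i = 0 := by omega
            rw [hself]
            intro h
            exact disjoint_left.1 (hdisj _ _ hw0) (hRA _ h) hx
          · rw [hself]
            refine hRge x (le_trans ?_ hx2')
            have : (0 : ℝ) ≤ #(A m) := by positivity
            change ε * #(A m) ≤ _
            nlinarith
          · intro h
            omega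
          · intro _
            rw [hself]
            have : candidates A (R x) m 0 (Function.update f 0 x) = A 1 := by
              rw [candidates, if_neg (by omega)]
              simp only [range_zero, image_empty, sdiff_empty, zero_add]
              exact sdiff_eq_self_of_disjoint ((hdisj _ _ hw1.symm).mono_right (hRA _))
            rw [this]
            exact hx1'
      · obtain ⟨k, rfl⟩ : ∃ k, j = k + 1 := ⟨j - 1, by omega⟩
        have hQ := hf k rfl
        have hdeg := hQ.degree (by omega)
        by_cases hk : k + 1 = m
        · refine ⟨{y ∈ candidates A (R (f 0)) m k f | G.Adj (f k) y}, ?_, ?_⟩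
          · refine le_trans ?_ hdeg
            rw [hk]
            refine hcm.trans ?_
            rw [candidates, if_pos hk]
            exact mul_le_mul_of_nonneg_left hQ.large (by linarith)
          · intro x hx k' hk'
            obtain rfl : k' = k + 1 := by omega
            obtain ⟨hx, hadj⟩ := mem_filter.1 hx
            exact hQ.update (by omega) hRA hx hadj (by omega)
        · have hlarge : ε * #(A (k + 1 + 1)) ≤ #(candidates A (R (f 0)) m (k + 1) f) := by
            by_cases hk2 : k + 1 + 1 = m
            · rw [candidates, if_pos hk2, hk2]
              exact hQ.large
            · exact (hroom (k + 1) (by omega)).trans (hcand (k + 1) f (by omega)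
                (Or.inr fun i hi => hQ.mem i (by omega)))
          have b := htyp (k + 1) (by omega) _ (hcandsub (k + 1) f) hlarge
          set B := {x ∈ Vs (w (k + 1)) |
            (#{y ∈ candidates A (R (f 0)) m (k + 1) f | G.Adj x y} : ℝ) <
              (d - ε) * #(candidates A (R (f 0)) m (k + 1) f)}
          refine ⟨{y ∈ candidates A (R (f 0)) m k f | G.Adj (f k) y} \ B, ?_, ?_⟩
          · have h := le_card_sdiff B {y ∈ candidates A (R (f 0)) m k f | G.Adj (f k) y}
            have h' : (#{y ∈ candidates A (R (f 0)) m k f | G.Adj (f k) y} : ℝ) ≤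
                #({y ∈ candidates A (R (f 0)) m k f | G.Adj (f k) y} \ B) + #B := by
              exact_mod_cast Nat.sub_le_iff_le_add.1 h
            have h2 := mul_le_mul_of_nonneg_left (hcand k f (by omega) (Or.inl hQ))
              (by linarith : 0 ≤ d - ε)
            have h3 := hck k (by omega)
            linarith
          · intro x hx k' hk'
            obtain rfl : k' = k + 1 := by omega
            obtain ⟨hx, hxB⟩ := mem_sdiff.1 hx
            obtain ⟨hx, hadj⟩ := mem_filter.1 hx
            refine hQ.update (by omega) hRA hx hadj fun _ => ?_
            by_contra! h
            exact hxB (mem_filter.2 ⟨hcandsub k f hx, h⟩))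
  refine ⟨S, hcard, fun f hf => ?_⟩
  obtain ⟨hP, hz⟩ := hS f hf
  have hQ := hP m rfl
  exact ⟨hQ.mem, hQ.inj, hQ.adj, ((mem_filter.1 (hRsub _ (hQ.last rfl))).2).symm, hz⟩

/-- A walk around the cycle `ZMod t` which alternates between `0` and `1` for the first `2 * b`
steps and goes around the cycle from then on. -/
def zigzagWalk (t b j : ℕ) : ZMod t :=
  if j < 2 * b then ((j % 2 : ℕ) : ZMod t) else ((j - 2 * b : ℕ) : ZMod t)

lemma zigzagWalk_of_lt {t b j : ℕ} (h : j < 2 * b) :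
    zigzagWalk t b j = ((j % 2 : ℕ) : ZMod t) := if_pos h

lemma zigzagWalk_add (t b j : ℕ) : zigzagWalk t b (2 * b + j) = (j : ZMod t) := by
  rw [zigzagWalk, if_neg (by omega), Nat.add_sub_cancel_left]

lemma zigzagWalk_succ (t b j : ℕ) : zigzagWalk t b (j + 1) = zigzagWalk t b j + 1 ∨
    zigzagWalk t b j = zigzagWalk t b (j + 1) + 1 := by
  by_cases h : j < 2 * b
  · rw [zigzagWalk_of_lt h]
    rcases Nat.mod_two_eq_zero_or_one j with h2 | h2
    · rw [zigzagWalk_of_lt (by omega), h2, Nat.add_mod, h2]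
      simp
    · have : zigzagWalk t b (j + 1) = 0 := by
        by_cases h' : j + 1 < 2 * b
        · rw [zigzagWalk_of_lt h', Nat.add_mod, h2]
          simp
        · obtain h' : j + 1 = 2 * b + 0 := by omega
          rw [h', zigzagWalk_add, Nat.cast_zero]
      rw [this, h2]
      simp
  · obtain ⟨i, rfl⟩ := Nat.exists_eq_add_of_le (not_lt.1 h)
    rw [add_assoc, zigzagWalk_add, zigzagWalk_add]
    simp

lemma card_filter_zigzagWalk_le {t : ℕ} (ht : 0 < t) (b k : ℕ) :
    #{i ∈ range k | zigzagWalk t b i = zigzagWalk t b (k + 1)} ≤ 2 * b + (k / t + 1) := by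
  by_cases hk : k + 1 < 2 * b
  · refine (card_filter_le _ _).trans ?_
    rw [card_range]
    exact Nat.le_add_right_of_le (by omega)
  · obtain ⟨l, hl⟩ := Nat.exists_eq_add_of_le (not_lt.1 hk)
    calc #{i ∈ range k | zigzagWalk t b i = zigzagWalk t b (k + 1)}
        ≤ #(range (2 * b) ∪ {i ∈ range k | i ≡ k + 1 [MOD t]}) := by
          refine card_le_card fun i hi => ?_
          obtain ⟨hi, hw⟩ := mem_filter.1 hi
          rw [mem_union, mem_range, mem_filter]
          refine or_iff_not_imp_left.2 fun hib => ⟨hi, ?_⟩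
          obtain ⟨i', rfl⟩ := Nat.exists_eq_add_of_le (not_lt.1 hib)
          rw [hl, zigzagWalk_add, zigzagWalk_add, ZMod.natCast_eq_natCast_iff] at hw
          rw [hl]
          exact hw.add_left _
      _ ≤ #(range (2 * b)) + #{i ∈ range k | i ≡ k + 1 [MOD t]} := card_union_le _ _
      _ ≤ 2 * b + (k / t + 1) := by
          rw [card_range, ← Nat.count_eq_card_filter_range, Nat.count_modEq_card _ ht]
          split_ifs <;> omega

lemma zmod_natCast_ne {t i j : ℕ} (hi : i < t) (hj : j < t) (h : i ≠ j) :
    (i : ZMod t) ≠ (j : ZMod t) := by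
  rw [Ne, ZMod.natCast_eq_natCast_iff]
  exact fun h' => h (Nat.ModEq.eq_of_lt_of_lt h' hi hj)

/-- The walk `zigzagWalk` of length `p` has no rotational symmetry. -/
lemma zigzagWalk_rigid {t b p : ℕ} [NeZero p] (ht : 3 ≤ t) (hb : 2 ≤ b) (hbp : 2 * b + 3 ≤ p)
    (hdvd : t ∣ p - 2 * b) {c : ZMod p}
    (hc : ∀ i : ZMod p, zigzagWalk t b (i + c).val = zigzagWalk t b i.val) : c = 0 := by
  have h01 : (0 : ZMod t) ≠ 1 := by
    simpa using zmod_natCast_ne (t := t) (i := 0) (j := 1) (by omega) (by omega) (by omega)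
  have h02 : (0 : ZMod t) ≠ 2 := by
    simpa using zmod_natCast_ne (t := t) (i := 0) (j := 2) (by omega) (by omega) (by omega)
  set a := (((2 * b - 1 : ℕ) : ZMod p) + c).val with ha
  have hap : a < p := ZMod.val_lt _
  have haz : (a : ZMod p) = ((2 * b - 1 : ℕ) : ZMod p) + c := ZMod.natCast_zmod_val _
  have key : ∀ e : ℕ, 2 * b - 1 + e < p →
      zigzagWalk t b ((a + e : ℕ) : ZMod p).val = zigzagWalk t b (2 * b - 1 + e) := by
    intro e he
    have := hc ((2 * b - 1 + e : ℕ) : ZMod p)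
    rw [ZMod.val_natCast_of_lt he] at this
    rw [← this, Nat.cast_add, haz, Nat.cast_add]
    congr 2
    ring
  have k0 : zigzagWalk t b a = 1 := by
    have := key 0 (by omega)
    rw [add_zero, add_zero, ZMod.val_natCast_of_lt hap, zigzagWalk_of_lt (j := 2 * b - 1)
      (by omega), show (2 * b - 1) % 2 = 1 by omega, Nat.cast_one] at this
    exact this
  have k1 : zigzagWalk t b ((a + 1 : ℕ) : ZMod p).val = 0 := by
    rw [key 1 (by omega), show 2 * b - 1 + 1 = 2 * b + 0 by omega, zigzagWalk_add, Nat.cast_zero]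
  have k3 : zigzagWalk t b ((a + 3 : ℕ) : ZMod p).val = 2 := by
    rw [key 3 (by omega), show 2 * b - 1 + 3 = 2 * b + 2 by omega, zigzagWalk_add, Nat.cast_two]
  have hab : a = 2 * b - 1 := by
    by_contra hne
    by_cases h : a < 2 * b
    · have hodd : a % 2 = 1 := by
        by_contra h'
        rw [zigzagWalk_of_lt h, show a % 2 = 0 by omega, Nat.cast_zero] at k0
        exact h01 k0
      rw [ZMod.val_natCast_of_lt (by omega)] at k3
      by_cases h3 : a + 3 < 2 * b
      · rw [zigzagWalk_of_lt h3, show (a + 3) % 2 = 0 by omega, Nat.cast_zero] at k3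
        exact h02 k3
      · rw [show a + 3 = 2 * b + 0 by omega, zigzagWalk_add, Nat.cast_zero] at k3
        exact h02 k3
    · obtain ⟨l, hl⟩ := Nat.exists_eq_add_of_le (not_lt.1 h)
      rw [hl, zigzagWalk_add] at k0
      by_cases hp : a + 1 < p
      · rw [ZMod.val_natCast_of_lt hp, hl, add_assoc, zigzagWalk_add, Nat.cast_add, k0,
          Nat.cast_one, one_add_one_eq_two] at k1
        exact h02 k1.symm
      · have : ((l + 1 : ℕ) : ZMod t) = 0 := by
          rw [ZMod.natCast_eq_zero_iff, show l + 1 = p - 2 * b by omega]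
          exact hdvd
        rw [Nat.cast_add, k0, Nat.cast_one, one_add_one_eq_two] at this
        exact h02 this.symm
  rw [hab] at haz
  exact left_eq_add.1 haz

/-- Rotating the cycles that follow a rotationally asymmetric pattern of disjoint sets produces
distinct cycles. -/
lemma mul_card_le_card_cycles {V ι : Type*} [Fintype V] (G : SimpleGraph V) {p : ℕ} [NeZero p]
    (Vs : ι → Finset V) (hdisj : ∀ i j, i ≠ j → Disjoint (Vs i) (Vs j)) (w : ℕ → ι)
    (hrigid : ∀ c : ZMod p, (∀ i : ZMod p, w (i + c).val = w i.val) → c = 0)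
    (S : Finset (ZMod p → V))
    (hS : ∀ f ∈ S, (∀ i, f i ∈ Vs (w i.val)) ∧ Function.Injective f ∧
      ∀ i, G.Adj (f i) (f (i + 1))) :
    p * #S ≤
      Nat.card {f : ZMod p → V // Function.Injective f ∧ ∀ i, G.Adj (f i) (f (i + 1))} := by
  let F : ZMod p × S →
      {f : ZMod p → V // Function.Injective f ∧ ∀ i, G.Adj (f i) (f (i + 1))} := fun x =>
    ⟨fun i => x.2.1 (i + x.1), (hS _ x.2.2).2.1.comp (add_left_injective _), fun i => by
      have := (hS _ x.2.2).2.2 (i + x.1)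
      rwa [add_right_comm] at this⟩
  have hF : Function.Injective F := by
    rintro ⟨k, f, hf⟩ ⟨k', f', hf'⟩ h
    have h1 : ∀ i, f (i + k) = f' (i + k') := fun i => congrFun (congrArg Subtype.val h) i
    have h2 : ∀ i, f (i + (k - k')) = f' i := fun i => by
      have := h1 (i - k')
      rwa [sub_add_cancel, sub_add_eq_add_sub, add_sub_assoc] at this
    have h3 : k - k' = 0 := by
      refine hrigid _ fun i => ?_
      by_contra hne
      have h4 := (hS f hf).1 (i + (k - k'))
      rw [h2] at h4
      exact disjoint_left.1 (hdisj _ _ hne) h4 ((hS f' hf').1 i)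
    have h5 : f = f' := funext fun i => by
      have := h2 i
      rwa [h3, add_zero] at this
    rw [sub_eq_zero] at h3
    subst h3 h5
    rfl
  have := Nat.card_le_card_of_injective F hF
  rwa [Nat.card_prod, Nat.card_zmod, Nat.card_eq_fintype_card (α := S), Fintype.card_coe] at this

lemma two_mul_add_mul_of_odd {t p : ℕ} (htodd : Odd t) (hpodd : Odd p) (ht : 3 ≤ t)
    (hp : 2 * t + 6 ≤ p) :
    ∃ b, 2 ≤ b ∧ 2 * b ≤ 4 * t - 1 ∧ 2 * b + 3 ≤ p ∧ t ∣ p - 2 * b := by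
  obtain ⟨r, hr⟩ := htodd
  obtain ⟨q, hq⟩ := hpodd
  have hdiv := Nat.div_add_mod (q - r - 3) t
  have hlt := Nat.mod_lt (q - r - 3) (show 0 < t by omega)
  set e := (q - r - 3) % t
  have hpe : p = 2 * (3 + e) + t * (2 * ((q - r - 3) / t) + 1) := by
    have : t * (2 * ((q - r - 3) / t) + 1) = 2 * (t * ((q - r - 3) / t)) + t := by ring
    omega
  have hpos : t ≤ t * (2 * ((q - r - 3) / t) + 1) := Nat.le_mul_of_pos_right _ (by omega)
  refine ⟨3 + e, by omega, by omega, by omega, ?_⟩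
  rw [hpe, Nat.add_sub_cancel_left]
  exact dvd_mul_right _ _

lemma path_step_bounds {s d A n q C T : ℝ} (hs : 0 < s) (hs1 : s ≤ 1 / 100) (hd : 10 * s ≤ d)
    (hd1 : d ≤ 1) (hn : 0 < n) (hA : n ≤ A) (hq : q ≤ (1 - 5 * s) * n)
    (hC : C ≤ q + 5 * T) (hT : T ≤ s ^ 4 * n) :
    s ^ 2 * A ≤ (1 - 2 * s ^ 2) * A - C ∧
    (d - 10 * s) * (n - q) ≤ (d - s ^ 2) * ((1 - 2 * s ^ 2) * A - C) - s ^ 2 * A ∧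
    2 * (s ^ 2 * n) ≤ (d - s ^ 2) * ((1 - 2 * s ^ 2) * A - C) - s ^ 2 * A := by
  have hA0 : 0 < A := hn.trans_le hA
  have hy : 5 * s * A ≤ A - q := by nlinarith
  have hsA : 0 < s * A := by positivity
  have hs4 : s ^ 4 * n ≤ s ^ 2 * A / 5 := by
    have h1 : s ^ 4 * n ≤ s ^ 4 * A := by gcongr
    have h2 : s ^ 4 * A = s ^ 2 * (s ^ 2 * A) := by ring
    have h3 : s ^ 2 ≤ 1 / 5 := by nlinarith
    have h4 : 0 ≤ s ^ 2 * A := by positivity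
    nlinarith
  have hβ : (A - q) - 3 * (s ^ 2 * A) ≤ (1 - 2 * s ^ 2) * A - C := by linarith
  have hsy : s ^ 2 * A ≤ s * (A - q) / 5 := by nlinarith
  have hβ' : (A - q) * (1 - 3 / 5 * s) ≤ (1 - 2 * s ^ 2) * A - C := by nlinarith
  have hy0 : 0 < A - q := by nlinarith
  have hds : 0 ≤ d - s ^ 2 := by nlinarith
  have hmul := mul_le_mul_of_nonneg_left hβ' hds
  have hcoef : d - 2 * s ≤ (d - s ^ 2) * (1 - 3 / 5 * s) - s / 5 := by nlinarith
  have hmain : (d - 2 * s) * (A - q) ≤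
      (d - s ^ 2) * ((1 - 2 * s ^ 2) * A - C) - s ^ 2 * A := by
    have := mul_le_mul_of_nonneg_right hcoef hy0.le
    nlinarith
  refine ⟨by nlinarith, ?_, ?_⟩
  · refine le_trans ?_ hmain
    exact mul_le_mul (by linarith) (by linarith) (by nlinarith) (by linarith)
  · refine le_trans ?_ hmain
    have h1 : s ^ 2 * n ≤ s ^ 2 * A := by gcongr
    have h2 : 8 * s * (5 * s * A) ≤ (d - 2 * s) * (A - q) :=
      mul_le_mul (by linarith) hy (by positivity) (by linarith)
    nlinarith

lemma adj_zmod_of_adj_nat {V : Type*} (G : SimpleGraph V) {m : ℕ} {f : ℕ → V}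
    (hadj : ∀ i < m, G.Adj (f i) (f (i + 1))) (hlast : G.Adj (f m) (f 0)) (i : ZMod (m + 1)) :
    G.Adj (f i.val) (f (i + 1).val) := by
  have hi : i.val < m + 1 := ZMod.val_lt i
  have hcast : i + 1 = ((i.val + 1 : ℕ) : ZMod (m + 1)) := by
    rw [Nat.cast_add, ZMod.natCast_zmod_val, Nat.cast_one]
  by_cases h : i.val < m
  · rw [hcast, ZMod.val_natCast_of_lt (by omega)]
    exact hadj _ h
  · obtain h : i.val = m := by omega
    rw [hcast, h, ZMod.natCast_self, ZMod.val_zero]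
    exact hlast

/-- Rotated copies of the cycles `f 0, …, f m` that follow an asymmetric pattern, counted among all
homomorphic embeddings of the cycle. -/
lemma mul_card_le_card_cycles_of_nat {V ι : Type*} [Fintype V] (G : SimpleGraph V) {m : ℕ}
    (Vs : ι → Finset V) (hdisj : ∀ i j, i ≠ j → Disjoint (Vs i) (Vs j)) (w : ℕ → ι)
    (hrigid : ∀ c : ZMod (m + 1), (∀ i : ZMod (m + 1), w (i + c).val = w i.val) → c = 0)
    (z : ℕ → V) (S : Finset (ℕ → V))
    (hS : ∀ f ∈ S, (∀ i ≤ m, f i ∈ Vs (w i)) ∧ (∀ i j, i < j → j ≤ m → f i ≠ f j) ∧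
      (∀ i < m, G.Adj (f i) (f (i + 1))) ∧ G.Adj (f m) (f 0) ∧
      ∀ k, m + 1 ≤ k → f k = z k) :
    (m + 1) * #S ≤ Nat.card {f : ZMod (m + 1) → V //
      Function.Injective f ∧ ∀ i, G.Adj (f i) (f (i + 1))} := by
  have hinj : Set.InjOn (fun (f : ℕ → V) (i : ZMod (m + 1)) => f i.val) S := by
    intro f hf f' hf' hff
    funext k
    by_cases hk : k < m + 1
    · have := congrFun hff (k : ZMod (m + 1))
      simpa only [ZMod.val_natCast_of_lt hk] using this
    · rw [(hS f hf).2.2.2.2 k (by omega), (hS f' hf').2.2.2.2 k (by omega)]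
  rw [← card_image_of_injOn hinj]
  refine mul_card_le_card_cycles G Vs hdisj w hrigid _ fun F hF => ?_
  obtain ⟨f, hf, rfl⟩ := mem_image.1 hF
  obtain ⟨hmem, hne, hadj, hlast, -⟩ := hS f hf
  refine ⟨fun i => hmem _ (Nat.lt_succ_iff.1 (ZMod.val_lt i)), ?_,
    adj_zmod_of_adj_nat G hadj hlast⟩
  intro i j hij
  have hi : i.val < m + 1 := ZMod.val_lt i
  have hj : j.val < m + 1 := ZMod.val_lt j
  apply ZMod.val_injective
  by_contra h
  rcases lt_or_gt_of_ne h with h | h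
  · exact hne _ _ h (by omega) hij
  · exact hne _ _ h (by omega) hij.symm

/-- Lower bound for the number of choices of the `j`-th vertex of a cycle of length `N + 4`. -/
def choiceBound (n a e : ℝ) (t N j : ℕ) : ℝ :=
  if j = 0 then n / 2 else if j ≤ N + 1 then a * (n - ((j - 1) / t : ℕ)) else
    if j = N + 2 then 2 * (e * n) else a * (e * n)

lemma prod_choiceBound (n a e : ℝ) (t N : ℕ) :
    ∏ j ∈ range (N + 4), choiceBound n a e t N j =
      e ^ 2 * n ^ 4 * a ^ (N + 2) * ∏ i ∈ Icc 1 N, (n - (i / t : ℕ)) := by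
  have hmid : ∏ k ∈ range (N + 1), choiceBound n a e t N (k + 1) =
      a ^ (N + 1) * (n * ∏ i ∈ Icc 1 N, (n - (i / t : ℕ))) := by
    have h1 : ∀ k ∈ range (N + 1), choiceBound n a e t N (k + 1) = a * (n - (k / t : ℕ)) := by
      intro k hk
      rw [mem_range] at hk
      rw [choiceBound, if_neg (by omega), if_pos (by omega), Nat.add_sub_cancel]
    rw [prod_congr rfl h1, prod_mul_distrib, prod_const, card_range, range_eq_Ico,
      prod_eq_prod_Ico_succ_bot (by omega)]
    simp only [Nat.zero_div, Nat.cast_zero, sub_zero, zero_add]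
    rfl
  have e0 : choiceBound n a e t N 0 = n / 2 := if_pos rfl
  have e2 : choiceBound n a e t N (N + 2) = 2 * (e * n) := by simp [choiceBound]
  have e3 : choiceBound n a e t N (N + 3) = a * (e * n) := by simp [choiceBound]
  rw [prod_range_succ, prod_range_succ, prod_range_succ', hmid, e0, e2, e3]
  ring

lemma three_le_mul_of_le_pow_four_mul {s n t : ℝ} (hs : 0 < s) (hs1 : s ≤ 1 / 100) (ht : 3 ≤ t)
    (htn : t ≤ s ^ 4 * n) : 3 ≤ s * (s ^ 2 * n) := by
  have h1 : s ^ 4 * n = s * (s * (s ^ 2 * n)) := by ring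
  nlinarith

lemma first_choice_bound {s n A : ℝ} (hs : 0 < s) (hs1 : s ≤ 1 / 100) (hA : n ≤ A)
    (hn : 3 ≤ s ^ 2 * n) : 2 ≤ (1 - 2 * s ^ 2) * A ∧ n / 2 ≤ (1 - 2 * s ^ 2) * A := by
  have h1 : s ^ 2 ≤ 1 / 10000 := by nlinarith
  have h2 : 0 < s ^ 2 := by positivity
  have h3 : 4 ≤ n := by nlinarith
  constructor <;> nlinarith

lemma last_choice_bound {s d n A : ℝ} (hs : 0 < s) (hs1 : s ≤ 1 / 100) (hd : 10 * s ≤ d)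
    (hA : n ≤ A) (hn : 0 ≤ n) (hsn : 3 ≤ s * (s ^ 2 * n)) :
    1 ≤ (d - s ^ 2) * (s ^ 2 * A) ∧
      (d - 10 * s) * (s ^ 2 * n) ≤ (d - s ^ 2) * (s ^ 2 * A) := by
  have h1 : s ^ 2 * n ≤ s ^ 2 * A := by gcongr
  have h2 : s ^ 2 ≤ s := by nlinarith
  have h3 : 0 ≤ s ^ 2 * n := by positivity
  constructor
  · have : 9 * s * (s ^ 2 * n) ≤ (d - s ^ 2) * (s ^ 2 * A) :=
      mul_le_mul (by linarith) h1 h3 (by linarith)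
    linarith
  · exact mul_le_mul (by linarith) h1 h3 (by linarith)

theorem stmt_4 {V : Type*} [Fintype V] (G : SimpleGraph V) (ε d : ℝ)
    (hε0 : 0 < ε) (hε : ε < (10 : ℝ) ^ (-5 : ℤ))
    (t n : ℕ) (htodd : Odd t) (ht : 3 ≤ t) (hnpos : 0 < n)
    (hn : (t : ℝ) * ε⁻¹ ^ 2 ≤ (n : ℝ))
    (Vs : ZMod t → Finset V)
    (hdisj : ∀ i j : ZMod t, i ≠ j → Disjoint (Vs i) (Vs j))
    (hsize : ∀ i : ZMod t, n ≤ (Vs i).card)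
    (hreg : ∀ i : ZMod t, IsRegularPair G ε (Vs i) (Vs (i + 1)))
    (hdens : ∀ i : ZMod t, d ≤ dens G (Vs i) (Vs (i + 1)))
    (hd : 10 * Real.sqrt ε ≤ d)
    (p : ℕ) (hpodd : Odd p) (hp : 2 * t + 6 ≤ p)
    (hpup : (p : ℝ) ≤ t * (1 - 5 * Real.sqrt ε) * n) :
    ε ^ 2 / 4 * (n : ℝ) ^ 4 * (d - 10 * Real.sqrt ε) ^ (p - 2) *
        (1 - 3 * Real.sqrt ε) ^ (2 * p) *
        ∏ i ∈ Finset.Icc 1 (p - 4), ((n : ℝ) - (i / t : ℕ)) ≤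
      (cycleCount G p : ℝ) := by
  set s := √ε with hs
  have hs0 : 0 < s := Real.sqrt_pos.2 hε0
  have hs2 : s ^ 2 = ε := Real.sq_sqrt hε0.le
  have hs1 : s ≤ 1 / 100 := by
    rw [hs, Real.sqrt_le_left (by norm_num)]
    norm_num at hε ⊢
    linarith
  have hn0 : (0 : ℝ) < n := by exact_mod_cast hnpos
  have ht3 : (3 : ℝ) ≤ t := by exact_mod_cast ht
  have htn : (t : ℝ) ≤ s ^ 4 * n := by
    rw [inv_pow, ← div_eq_mul_inv, div_le_iff₀ (by positivity), ← hs2] at hn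
    linarith
  have hsεn := three_le_mul_of_le_pow_four_mul hs0 hs1 ht3 htn
  have hε1 : ε ≤ s / 100 := by
    rw [← hs2, sq]
    linarith [mul_le_mul_of_nonneg_left hs1 hs0.le]
  have hεn : 3 ≤ s ^ 2 * n :=
    hsεn.trans (mul_le_of_le_one_left (by positivity) (by linarith))
  have hd1 : d ≤ 1 := (hdens 0).trans (dens_le_one G _ _)
  have hsizeR : ∀ i, (n : ℝ) ≤ #(Vs i) := fun i => by exact_mod_cast hsize i
  obtain ⟨b, hb2, hbt, hbp, hdvd⟩ := two_mul_add_mul_of_odd htodd hpodd ht hp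
  obtain ⟨N, rfl⟩ : ∃ N, p = N + 4 := ⟨p - 4, by omega⟩
  set w := zigzagWalk t b with hw
  have hwm : w (N + 3) + 1 = w 0 := by
    obtain ⟨l, hl⟩ := Nat.exists_eq_add_of_le (show 2 * b ≤ N + 3 by omega)
    have h0 : ((l + 1 : ℕ) : ZMod t) = 0 := by
      rw [ZMod.natCast_eq_zero_iff, show l + 1 = N + 4 - 2 * b by omega]
      exact hdvd
    rw [hw, hl, zigzagWalk_add, zigzagWalk_of_lt (by omega)]
    simpa using h0
  have hw0 : w 0 = 0 := by
    rw [hw, zigzagWalk_of_lt (by omega)]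
    simp
  have hw1 : w 1 = 1 := by
    rw [hw, zigzagWalk_of_lt (by omega)]
    simp
  have h01 : (0 : ZMod t) ≠ 1 := by
    simpa using zmod_natCast_ne (t := t) (i := 0) (j := 1) (by omega) (by omega) (by omega)
  have h02 : (0 : ZMod t) ≠ 2 := by
    simpa using zmod_natCast_ne (t := t) (i := 0) (j := 2) (by omega) (by omega) (by omega)
  have hfwd : ∀ i, HasTypicalDegrees G ε d (Vs i) (Vs (i + 1)) := fun i =>
    (hreg i).hasTypicalDegrees hε0 (hdens i)
  have hbwd : ∀ i, HasTypicalDegrees G ε d (Vs (i + 1)) (Vs i) := fun i =>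
    (hreg i).symm.hasTypicalDegrees hε0 ((hdens i).trans_eq (dens_comm G _ _))
  have hq : ∀ k, k ≤ N → ((k / t : ℕ) : ℝ) ≤ (1 - 5 * s) * n := by
    intro k hk
    have h1 : ((k / t * t : ℕ) : ℝ) ≤ ((N + 4 : ℕ) : ℝ) := by
      exact_mod_cast (Nat.div_mul_le_self k t).trans (by omega)
    rw [Nat.cast_mul] at h1
    have h2 := h1.trans hpup
    have h3 : (t : ℝ) * ((k / t : ℕ) : ℝ) ≤ t * ((1 - 5 * s) * n) := by linarith
    exact le_of_mul_le_mul_left h3 (by linarith)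
  have hqn : ∀ k, k ≤ N → (0 : ℝ) ≤ n - (k / t : ℕ) := fun k hk => by
    have := hq k hk
    have : 0 ≤ s * n := by positivity
    linarith
  have hstep : ∀ k, k ≤ N + 1 → _ := fun k hk =>
    path_step_bounds (C := #{i ∈ range k | w i = w (k + 1)}) (q := ((min k N / t : ℕ) : ℝ))
      (T := t) hs0 hs1 hd hd1 hn0 (hsizeR (w (k + 1))) (hq _ (min_le_right _ _)) (by
        have h1 := card_filter_zigzagWalk_le (show 0 < t by omega) b k
        have h2 : k / t ≤ min k N / t + 1 := by
          rw [← Nat.add_div_right _ (by omega)]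
          exact Nat.div_le_div_right (by omega)
        have h3 : #{i ∈ range k | w i = w (k + 1)} ≤ min k N / t + 5 * t := by
          refine h1.trans ?_
          omega
        exact_mod_cast h3) htn
  rw [hs2] at hstep hεn
  set g := choiceBound n (d - 10 * s) ε t N with hg
  set h : ℕ → ℝ := fun j => if j = 0 then 2 else 1 with hh
  have hg0 : ∀ j, 0 ≤ g j := by
    intro j
    rw [hg, choiceBound]
    split_ifs with h1 h2
    · positivity
    · exact mul_nonneg (by linarith) (hqn _ (by omega))
    · positivity
    · exact mul_nonneg (by linarith) (by positivity)
  have hh0 : ∀ j, 0 ≤ h j := fun j => by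
    simp only [hh]
    split_ifs <;> norm_num
  have hv : (Vs 0).Nonempty := card_pos.1 (hnpos.trans_le (hsize 0))
  obtain ⟨S, hScard, hS⟩ := exists_finset_cycles G (ε := ε) (d := d) Vs hdisj w
    (m := N + 3) (by omega)
    (fun h => by rw [h, add_eq_left] at hwm; exact h01 hwm.symm)
    (fun h => by rw [h, hw0, hw1, one_add_one_eq_two] at hwm; exact h02 hwm.symm)
    (fun j _ => by
      rcases zigzagWalk_succ t b j with h | h
      · rw [← hw] at h
        rw [h]
        exact hfwd _
      · rw [← hw] at h
        rw [h]
        exact hbwd _)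
    (by rw [← hwm]; exact hbwd _) hε0 (by linarith) (by linarith)
    (by
      have := mul_le_mul_of_nonneg_left (hsizeR (w (N + 3))) hε0.le
      linarith)
    (fun k hk => (hstep k (by omega)).1)
    (fun j => max (h j) (g j)) (fun j => le_max_of_le_right (hg0 j))
    (by
      have := first_choice_bound hs0 hs1 (hsizeR (w 0)) (hεn.trans_eq (by rw [hs2]))
      rw [hs2] at this
      simp only [hh, hg, choiceBound, if_true]
      exact max_le this.1 this.2)
    (fun k hk => by
      obtain ⟨-, hA, hB⟩ := hstep k (by omega)
      simp only [hh, hg, choiceBound, if_neg (Nat.succ_ne_zero k), Nat.add_sub_cancel]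
      refine max_le ?_ ?_
      · linarith
      split_ifs with h1 h2
      · rwa [min_eq_left (by omega)] at hA
      · exact hB
      · omega)
    (by
      have := last_choice_bound hs0 hs1 hd (hsizeR (w (N + 3))) hn0.le hsεn
      rw [hs2] at this
      simp only [hh, hg, choiceBound]
      rw [if_neg (by omega), if_neg (by omega), if_neg (by omega), if_neg (by omega)]
      exact max_le this.1 this.2)
    (fun _ => hv.choose)
  have hS2 : (2 : ℝ) ≤ #S := by
    refine le_trans ?_ (hScard.trans' (prod_le_prod (fun j _ => hh0 j) fun j _ => le_max_left _ _))
    simp [hh, prod_ite_eq']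
  have hSg : ∏ j ∈ range (N + 4), g j ≤ #S :=
    hScard.trans' (prod_le_prod (fun j _ => hg0 j) fun j _ => le_max_right _ _)
  have hcyc : (N + 4) * #S ≤ Nat.card {f : ZMod (N + 4) → V //
      Function.Injective f ∧ ∀ i, G.Adj (f i) (f (i + 1))} :=
    mul_card_le_card_cycles_of_nat G Vs hdisj w
      (fun c hc => zigzagWalk_rigid ht hb2 hbp hdvd hc) _ S hS
  have hdiv : #S / 2 ≤ cycleCount G (N + 4) := by
    rw [cycleCount, mul_comm 2, ← Nat.div_div_eq_div_mul]
    refine Nat.div_le_div_right ?_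
    rwa [Nat.le_div_iff_mul_le (by omega), mul_comm]
  have hquarter : (#S : ℝ) / 4 ≤ cycleCount G (N + 4) := by
    have h1 : 2 ≤ #S := by exact_mod_cast hS2
    have h2 : #S ≤ 4 * cycleCount G (N + 4) := by omega
    have h3 : (#S : ℝ) ≤ 4 * cycleCount G (N + 4) := by exact_mod_cast h2
    linarith
  refine le_trans ?_ hquarter
  have hpow : (1 - 3 * s) ^ (2 * (N + 4)) ≤ 1 := pow_le_one₀ (by linarith) (by linarith)
  have hX : 0 ≤ ∏ j ∈ range (N + 4), g j := prod_nonneg fun j _ => hg0 j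
  rw [show N + 4 - 2 = N + 2 by omega, Nat.add_sub_cancel]
  calc _ = (∏ j ∈ range (N + 4), g j) / 4 * (1 - 3 * s) ^ (2 * (N + 4)) := by
        rw [hg, prod_choiceBound]; ring
    _ ≤ (∏ j ∈ range (N + 4), g j) / 4 := mul_le_of_le_one_right (by linarith) hpow
    _ ≤ #S / 4 := by linarith
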